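/- arXiv:1407.1706 — 2 statements merged into one kernel-verified Lean document; each statement's English description precedes it below -/
import Mathlib

section
/- Let G be a simple graph and K = {v_1, ..., v_r} a clique in G such that no vertex of K belongs to a homogeneous set of size > 1 among K (i.e., any two vertices of K have distinct neighborhoods outside K). Suppose the neighborhood N(K) of K outside K is bipartitioned into sets A and B such that, setting A_i = A ∩ N(v_i) and B_i = B ∩ N(v_i), we have A_{i+1} ⊆ A_i and B_i ⊆ B_{i+1} for all i, and B_i ≠ ∅ for all i. Then |K| ≤ |N(K)|. -/
/-- A strictly increasing chain of `r` nonempty subsets of a finite set `S` has `r ≤ |S|`. -/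
theorem le_ncard_of_strictMono_nonempty {α : Type*} {r : ℕ} {S : Set α} (hS : S.Finite)
    {f : Fin r → Set α} (hf : StrictMono f) (hne : ∀ i, (f i).Nonempty) (hsub : ∀ i, f i ⊆ S) :
    r ≤ S.ncard := by
  have hfin : ∀ i, (f i).Finite := fun i => hS.subset (hsub i)
  have hmono : StrictMono fun i => (f i).ncard := fun i j hij =>
    Set.ncard_lt_ncard (hf hij) (hfin j)
  have hcard := Finset.card_le_card_of_injOn (s := Finset.univ) (t := Finset.Icc 1 S.ncard)
    (fun i => (f i).ncard)
    (fun i _ => by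
      have hpos : 0 < (f i).ncard := (Set.ncard_pos (hfin i)).2 (hne i)
      have hle : (f i).ncard ≤ S.ncard := Set.ncard_le_ncard (hsub i) hS
      simpa using And.intro (Nat.succ_le_of_lt hpos) hle)
    hmono.injective.injOn
  simpa using hcard

/-- Let `K = {v_1, …, v_r}` be a clique whose vertices have pairwise distinct
neighborhoods outside `K`, whose outside neighborhood `N(K)` is bipartitioned into
`A` and `B` with `A_{i+1} ⊆ A_i`, `B_i ⊆ B_{i+1}` and `B_i ≠ ∅` for all `i`.
Then `|K| ≤ |N(K)|`. -/
theorem stmt14 {V : Type*} [Fintype V] (G : SimpleGraph V) (r : ℕ)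
    (v : Fin r → V) (hinj : Function.Injective v)
    (hclique : ∀ i j, i ≠ j → G.Adj (v i) (v j))
    (hdistinct : ∀ i j : Fin r, i ≠ j →
      G.neighborSet (v i) \ Set.range v ≠ G.neighborSet (v j) \ Set.range v)
    (A B : Set V)
    (hAB : A ∪ B = {w | w ∉ Set.range v ∧ ∃ i, G.Adj (v i) w})
    (hdisj : Disjoint A B)
    (hnest : ∀ i j : Fin r, i ≤ j →
      A ∩ G.neighborSet (v j) ⊆ A ∩ G.neighborSet (v i) ∧
      B ∩ G.neighborSet (v i) ⊆ B ∩ G.neighborSet (v j))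
    (hBne : ∀ i, (B ∩ G.neighborSet (v i)).Nonempty) :
    r ≤ {w | w ∉ Set.range v ∧ ∃ i, G.Adj (v i) w}.ncard := by
  have hmem : ∀ w, w ∈ A ∨ w ∈ B ↔ w ∉ Set.range v ∧ ∃ i, G.Adj (v i) w :=
    fun w => Set.ext_iff.1 hAB w
  let f : Fin r → Set V := fun j => (A \ G.neighborSet (v j)) ∪ (B ∩ G.neighborSet (v j))
  have hmono : Monotone f := by
    rintro i j hij w (⟨hA, hw⟩ | hw)
    · exact Or.inl ⟨hA, fun h => hw ((hnest i j hij).1 ⟨hA, h⟩).2⟩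
    · exact Or.inr ((hnest i j hij).2 hw)
  have hfinj : Function.Injective f := by
    intro i j hij
    by_contra hne
    refine hdistinct i j hne (Set.ext fun w => and_congr_left fun hw => ?_)
    have hf : (w ∈ A ∧ ¬ G.Adj (v i) w) ∨ (w ∈ B ∧ G.Adj (v i) w) ↔
        (w ∈ A ∧ ¬ G.Adj (v j) w) ∨ (w ∈ B ∧ G.Adj (v j) w) := Set.ext_iff.1 hij w
    have hAB' : w ∈ A → w ∉ B := fun ha hb => Set.disjoint_left.1 hdisj ha hb
    have hi : G.Adj (v i) w → w ∈ A ∨ w ∈ B := fun h => (hmem w).2 ⟨hw, i, h⟩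
    have hj : G.Adj (v j) w → w ∈ A ∨ w ∈ B := fun h => (hmem w).2 ⟨hw, j, h⟩
    change G.Adj (v i) w ↔ G.Adj (v j) w
    tauto
  refine le_ncard_of_strictMono_nonempty (Set.toFinite _) (hmono.strictMono_of_injective hfinj)
    (fun i => (hBne i).mono Set.subset_union_right) fun i => ?_
  rw [← hAB]
  exact Set.union_subset_union Set.sdiff_subset Set.inter_subset_left
end

section
/- Let φ be a 3-CNF formula with clauses c_1, ..., c_m. Construct the graph G_φ with one vertex per literal occurrence: for each clause a triangle on its three literal vertices, and an edge between every vertex labeled x and every vertex labeled ¬x for each variable x. Then φ is satisfiable if and only if G_φ has an independent set of size m. -/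
/-- A set of vertices is independent if its vertices are pairwise non-adjacent. -/
def SimpleGraph.IsIndepSet' {V : Type*} (G : SimpleGraph V) (s : Set V) : Prop :=
  s.Pairwise fun u v => ¬ G.Adj u v

/-- The graph `G_φ` of the classical reduction: one vertex per literal occurrence
`(j, i)` (the `i`-th literal of clause `j`), a triangle on each clause, and an edge
between every pair of occurrences of complementary literals. A literal is a pair
(variable, polarity). -/
def satGraph (n m : ℕ) (clauses : Fin m → Fin 3 → Fin n × Bool) :
    SimpleGraph (Fin m × Fin 3) :=
  SimpleGraph.fromRel (fun a b =>
    a.1 = b.1 ∨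
      ((clauses a.1 a.2).1 = (clauses b.1 b.2).1 ∧
        (clauses a.1 a.2).2 ≠ (clauses b.1 b.2).2))

/-- A set is independent in `satGraph` iff distinct members lie in distinct clauses and carry
non-complementary literals. -/
theorem satGraph_isIndepSet'_iff {n m : ℕ} {clauses : Fin m → Fin 3 → Fin n × Bool}
    {s : Set (Fin m × Fin 3)} :
    (satGraph n m clauses).IsIndepSet' s ↔
      Set.InjOn Prod.fst s ∧
        ∀ p ∈ s, ∀ q ∈ s, (clauses p.1 p.2).1 = (clauses q.1 q.2).1 →
          (clauses p.1 p.2).2 = (clauses q.1 q.2).2 := by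
  simp only [SimpleGraph.IsIndepSet', satGraph, Set.Pairwise, SimpleGraph.fromRel_adj]
  constructor
  · intro h
    refine ⟨fun p hp q hq hpq => ?_, fun p hp q hq hpq => ?_⟩
    · by_contra hne
      exact h hp hq hne ⟨hne, .inl (.inl hpq)⟩
    · by_contra hne
      have hpq' : p ≠ q := by
        rintro rfl
        exact hne rfl
      exact h hp hq hpq' ⟨hpq', .inl (.inr ⟨hpq, hne⟩)⟩
  · rintro ⟨hinj, hcons⟩ p hp q hq hne ⟨-, (h | ⟨h, h'⟩) | (h | ⟨h, h'⟩)⟩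
    · exact hne (hinj hp hq h)
    · exact h' (hcons p hp q hq h)
    · exact hne (hinj hp hq h.symm)
    · exact h' (hcons q hq p hp h)

/-- A 3-CNF formula `φ` with `m` clauses is satisfiable iff the graph `G_φ` has an
independent set of size `m`. -/
theorem stmt18 (n m : ℕ) (clauses : Fin m → Fin 3 → Fin n × Bool) :
    (∃ a : Fin n → Bool, ∀ j : Fin m, ∃ i : Fin 3,
        a (clauses j i).1 = (clauses j i).2) ↔
    (∃ S : Finset (Fin m × Fin 3),
        (satGraph n m clauses).IsIndepSet' ↑S ∧ S.card = m) := by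
  simp only [satGraph_isIndepSet'_iff]
  constructor
  · rintro ⟨a, ha⟩
    choose f hf using ha
    refine ⟨Finset.univ.image fun j => (j, f j), ⟨?_, ?_⟩, ?_⟩
    · intro p hp q hq hpq
      simp only [Finset.coe_image, Finset.coe_univ, Set.image_univ, Set.mem_range] at hp hq
      grind
    · intro p hp q hq hpq
      simp only [Finset.coe_image, Finset.coe_univ, Set.image_univ, Set.mem_range] at hp hq
      obtain ⟨j, rfl⟩ := hp
      obtain ⟨k, rfl⟩ := hq
      rw [← hf j, ← hf k, hpq]
    · rw [Finset.card_image_of_injective _ fun j k h => congrArg Prod.fst h, Finset.card_fin]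
  · rintro ⟨S, ⟨hinj, hcons⟩, hcard⟩
    have himage : S.image Prod.fst = Finset.univ := by
      rw [← Finset.card_eq_iff_eq_univ, Finset.card_image_of_injOn hinj, hcard, Fintype.card_fin]
    classical
    refine ⟨fun x => decide (∃ p ∈ S, clauses p.1 p.2 = (x, true)), fun j => ?_⟩
    obtain ⟨⟨k, i⟩, hp, rfl⟩ := Finset.mem_image.mp (himage ▸ Finset.mem_univ j)
    refine ⟨i, ?_⟩
    rw [Bool.eq_iff_iff, decide_eq_true_iff]
    constructor
    · rintro ⟨q, hq, hqx⟩
      simpa [hqx] using (hcons q hq (k, i) hp (by simp [hqx])).symm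
    · exact fun h => ⟨(k, i), hp, Prod.ext rfl h⟩
end
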